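/- Let K > 0 be a constant. There exist constants C' and C'', depending only on c_1 and K, such that the following holds whenever λ ≥ 1, m ≥ ℓ ≥ C' r and λ m/(r √s) ≤ K. Let X be a random variable whose law lies in ℬ_{r,s}, and let I_1 and I_2 be half-open subintervals, each of length ℓ, of an interval J of length m with J ⊆ [−K λ r √s, K λ r √s]. Then |P(X ∈ I_2) − P(X ∈ I_1)| ≤ C'' · P(X ∈ I_1) · (r/ℓ + λ m/(r √s)). -/

import Mathlib

open MeasureTheory ProbabilityTheory

/-- Binary convolution of laws on `ℝ`. -/
noncomputable def mconvR (μ ν : Measure ℝ) : Measure ℝ :=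
  μ.bind (fun x => ν.map (fun y => x + y))

/-- Convolution of a finite family of laws on `ℝ`. -/
noncomputable def mconvFamR : {s : ℕ} → (Fin s → Measure ℝ) → Measure ℝ
  | 0, _ => Measure.dirac 0
  | (_ + 1), ν => mconvR (ν 0) (mconvFamR (fun i => ν i.succ))

/-- The class `𝒟_r`: laws of real random variables `X` with `E X = 0`, `|X| ≤ 4r` a.s. and
`Var X ≥ c₁ (r/2)²`. -/
def MemD (c₁ r : ℝ) (ν : Measure ℝ) : Prop :=
  IsProbabilityMeasure ν ∧ (∫ x, x ∂ν) = 0 ∧ (∀ᵐ x ∂ν, |x| ≤ 4 * r) ∧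
    c₁ * (r / 2) ^ 2 ≤ variance (fun x => x) ν

/-- The class `ℬ_{r,s}`: `s`-fold convolutions of laws from `𝒟_r`. -/
def MemB (c₁ r : ℝ) (s : ℕ) (ν : Measure ℝ) : Prop :=
  ∃ f : Fin s → Measure ℝ, (∀ i, MemD c₁ r (f i)) ∧ ν = mconvFamR f

open Set

theorem integrable_of_ae_mem_isCompact {α : Type*} [TopologicalSpace α] [MeasurableSpace α]
    [OpensMeasurableSpace α] [T2Space α] [TopologicalSpace.PseudoMetrizableSpace α]
    {μ : Measure α} [IsFiniteMeasure μ]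
    {S : Set α} (hS : IsCompact S) (hμ : ∀ᵐ x ∂μ, x ∈ S) {g : α → ℝ} (hg : Continuous g) :
    Integrable g μ := by
  have h := hg.continuousOn.integrableOn_compact (μ := μ) hS
  rwa [IntegrableOn, Measure.restrict_eq_self_of_ae_mem hμ] at h

theorem integrable_of_ae_abs_le {μ : Measure ℝ} [IsFiniteMeasure μ] {b : ℝ}
    (hb : ∀ᵐ x ∂μ, |x| ≤ b) {g : ℝ → ℝ} (hg : Continuous g) : Integrable g μ :=
  integrable_of_ae_mem_isCompact (isCompact_Icc (a := -b) (b := b))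
    (hb.mono fun _ hx => abs_le.1 hx) hg

/-- Truncation of `w` to the interval `[a, b]`. -/
noncomputable def clampR (a b w : ℝ) : ℝ := max a (min w b)

@[fun_prop]
theorem continuous_clampR (a b : ℝ) : Continuous (clampR a b) := by
  unfold clampR; fun_prop

theorem clampR_add (a b x y : ℝ) : clampR a b (x + y) = clampR (a - y) (b - y) x + y := by
  unfold clampR
  rw [max_add, min_add]
  simp

/-- Stein-type comparison: `E[(W - M) clamp(W)]` is sandwiched between `v` times the
probabilities of slightly shrunk and slightly enlarged intervals. -/
structure SteinSandwich (D M v : ℝ) (μ : Measure ℝ) : Prop where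
  prob : IsProbabilityMeasure μ
  bdd : ∃ b, ∀ᵐ x ∂μ, |x| ≤ b
  mean : ∫ x, x ∂μ = M
  lower : ∀ a b, a ≤ b → v * μ.real (Icc (a + D) (b - D)) ≤ ∫ w, (w - M) * clampR a b w ∂μ
  upper : ∀ a b, a ≤ b → ∫ w, (w - M) * clampR a b w ∂μ ≤ v * μ.real (Icc (a - D) (b + D))

namespace SteinSandwich

variable {D M M' v v' : ℝ} {μ ν : Measure ℝ}

theorem integrable (h : SteinSandwich D M v μ) {g : ℝ → ℝ} (hg : Continuous g) :
    Integrable g μ := by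
  have := h.prob
  obtain ⟨b, hb⟩ := h.bdd
  exact integrable_of_ae_abs_le hb hg

theorem integral_sub_mean (h : SteinSandwich D M v μ) : ∫ x, (x - M) ∂μ = 0 := by
  have := h.prob
  rw [integral_sub (h.integrable (g := fun x => x) continuous_id) (integrable_const _), h.mean]
  simp

theorem integral_mul_add_const (h : SteinSandwich D M v μ) {g : ℝ → ℝ} (hg : Continuous g)
    (k : ℝ) : ∫ x, (x - M) * (g x + k) ∂μ = ∫ x, (x - M) * g x ∂μ := by
  simp_rw [mul_add]
  rw [integral_add (h.integrable (by fun_prop)) (h.integrable (by fun_prop)),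
    integral_mul_const, h.integral_sub_mean]
  simp

theorem integral_clampR_shift (h : SteinSandwich D M v μ) (a b y : ℝ) :
    ∫ x, (x - M) * clampR a b (x + y) ∂μ = ∫ x, (x - M) * clampR (a - y) (b - y) x ∂μ := by
  simp_rw [clampR_add]
  exact h.integral_mul_add_const (by fun_prop) y

theorem exists_prod_compact (h : SteinSandwich D M v μ) (h' : SteinSandwich D M' v' ν) :
    ∃ S : Set (ℝ × ℝ), IsCompact S ∧ ∀ᵐ p ∂(μ.prod ν), p ∈ S := by
  have := h.prob
  have := h'.prob
  obtain ⟨b, hb⟩ := h.bdd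
  obtain ⟨b', hb'⟩ := h'.bdd
  refine ⟨Icc (-b) b ×ˢ Icc (-b') b', isCompact_Icc.prod isCompact_Icc, ?_⟩
  have h1 : ∀ᵐ p ∂(μ.prod ν), |p.1| ≤ b := Measure.quasiMeasurePreserving_fst.ae hb
  have h2 : ∀ᵐ p ∂(μ.prod ν), |p.2| ≤ b' := Measure.quasiMeasurePreserving_snd.ae hb'
  filter_upwards [h1, h2] with p hp hp'
  exact ⟨abs_le.1 hp, abs_le.1 hp'⟩

theorem integrable_prod (h : SteinSandwich D M v μ) (h' : SteinSandwich D M' v' ν)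
    {g : ℝ × ℝ → ℝ} (hg : Continuous g) : Integrable g (μ.prod ν) := by
  have := h.prob
  have := h'.prob
  obtain ⟨S, hS, hm⟩ := h.exists_prod_compact h'
  exact integrable_of_ae_mem_isCompact hS hm hg

theorem measureReal_conv [IsProbabilityMeasure μ] [IsProbabilityMeasure ν] {S : Set ℝ}
    (hS : MeasurableSet S) :
    Integrable (fun y => μ.real ((fun x => x + y) ⁻¹' S)) ν ∧
      (μ.conv ν).real S = ∫ y, μ.real ((fun x => x + y) ⁻¹' S) ∂ν := by
  have hT : MeasurableSet ((fun p : ℝ × ℝ => p.1 + p.2) ⁻¹' S) :=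
    (measurable_fst.add measurable_snd) hS
  have hint : Integrable (((fun p : ℝ × ℝ => p.1 + p.2) ⁻¹' S).indicator (fun _ => (1 : ℝ)))
      (μ.prod ν) := (integrable_const _).indicator hT
  have hy : ∀ y, ∫ x, ((fun p : ℝ × ℝ => p.1 + p.2) ⁻¹' S).indicator (fun _ => (1 : ℝ)) (x, y) ∂μ
      = μ.real ((fun x => x + y) ⁻¹' S) := by
    intro y
    rw [← integral_indicator_one ((measurable_add_const y) hS)]
    rfl
  refine ⟨by simpa only [hy] using hint.integral_prod_right, ?_⟩
  rw [Measure.conv, map_measureReal_apply (by fun_prop) hS, ← integral_indicator_one hT]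
  simp_rw [← hy]
  exact integral_prod_symm _ hint

theorem prod_bounds (h : SteinSandwich D M v μ) (h' : SteinSandwich D M' v' ν) {a b : ℝ}
    (hab : a ≤ b) :
    v * (μ.conv ν).real (Icc (a + D) (b - D))
        ≤ ∫ p, (p.1 - M) * clampR a b (p.1 + p.2) ∂(μ.prod ν) ∧
      ∫ p, (p.1 - M) * clampR a b (p.1 + p.2) ∂(μ.prod ν)
        ≤ v * (μ.conv ν).real (Icc (a - D) (b + D)) := by
  have := h.prob
  have := h'.prob
  have hint : Integrable (fun p : ℝ × ℝ => (p.1 - M) * clampR a b (p.1 + p.2)) (μ.prod ν) :=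
    h.integrable_prod h' (by fun_prop)
  have hpre : ∀ y c d : ℝ, (fun x => x + y) ⁻¹' Icc c d = Icc (c - y) (d - y) := by
    intro y c d; simp
  obtain ⟨hi₁, he₁⟩ := measureReal_conv (μ := μ) (ν := ν)
    (measurableSet_Icc (a := a + D) (b := b - D))
  obtain ⟨hi₂, he₂⟩ := measureReal_conv (μ := μ) (ν := ν)
    (measurableSet_Icc (a := a - D) (b := b + D))
  rw [integral_prod_symm _ hint, he₁, he₂, ← integral_const_mul, ← integral_const_mul]
  constructor
  · refine integral_mono (hi₁.const_mul v) hint.integral_prod_right fun y => ?_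
    simp only [hpre]
    rw [h.integral_clampR_shift]
    have := h.lower (a - y) (b - y) (by linarith)
    rwa [sub_add_eq_add_sub, sub_right_comm b y D] at this
  · refine integral_mono hint.integral_prod_right (hi₂.const_mul v) fun y => ?_
    simp only [hpre]
    rw [h.integral_clampR_shift]
    have := h.upper (a - y) (b - y) (by linarith)
    rwa [sub_right_comm a y D, sub_add_eq_add_sub] at this

theorem conv (h : SteinSandwich D M v μ) (h' : SteinSandwich D M' v' ν) :
    SteinSandwich D (M + M') (v + v') (μ.conv ν) := by
  have := h.prob
  have := h'.prob
  have hsum : ∀ a b : ℝ, ∫ w, (w - (M + M')) * clampR a b w ∂(μ.conv ν)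
      = ∫ p, (p.1 - M) * clampR a b (p.1 + p.2) ∂(μ.prod ν)
        + ∫ p, (p.1 - M') * clampR a b (p.1 + p.2) ∂(ν.prod μ) := by
    intro a b
    have hswap : ∫ p, (p.1 - M') * clampR a b (p.1 + p.2) ∂(ν.prod μ)
        = ∫ p, (p.2 - M') * clampR a b (p.1 + p.2) ∂(μ.prod ν) := by
      rw [← integral_prod_swap]
      simp [add_comm]
    rw [hswap, ← integral_add (h.integrable_prod h' (by fun_prop))
      (h.integrable_prod h' (by fun_prop)), Measure.conv,
      integral_map (by fun_prop) (Continuous.aestronglyMeasurable (by fun_prop))]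
    congr 1; ext p; ring
  refine ⟨inferInstance, ?_, ?_, ?_, ?_⟩
  · obtain ⟨b, hb⟩ := h.bdd
    obtain ⟨b', hb'⟩ := h'.bdd
    refine ⟨b + b', ?_⟩
    rw [Measure.conv, ae_map_iff (by fun_prop)
      (measurableSet_le (by fun_prop) (by fun_prop))]
    have h1 : ∀ᵐ p ∂(μ.prod ν), |p.1| ≤ b := Measure.quasiMeasurePreserving_fst.ae hb
    have h2 : ∀ᵐ p ∂(μ.prod ν), |p.2| ≤ b' := Measure.quasiMeasurePreserving_snd.ae hb'
    filter_upwards [h1, h2] with p hp hp'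
    exact (abs_add_le _ _).trans (add_le_add hp hp')
  · rw [Measure.conv, integral_map (by fun_prop) (Continuous.aestronglyMeasurable (by fun_prop)),
      integral_add (h.integrable_prod h' (by fun_prop)) (h.integrable_prod h' (by fun_prop)),
      integral_fun_fst (fun x => x), integral_fun_snd (fun x => x)]
    simp [h.mean, h'.mean]
  · intro a b hab
    rw [hsum, add_mul]
    refine add_le_add (h.prod_bounds h' hab).1 ?_
    rw [Measure.conv_comm]
    exact (h'.prod_bounds h hab).1
  · intro a b hab
    rw [hsum, add_mul]
    refine add_le_add (h.prod_bounds h' hab).2 ?_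
    rw [Measure.conv_comm]
    exact (h'.prod_bounds h hab).2

end SteinSandwich

theorem clampR_of_mem {a b w : ℝ} (h : w ∈ Icc a b) : clampR a b w = w := by
  rw [clampR, min_eq_left h.2, max_eq_right h.1]

theorem clampR_of_le {a b w : ℝ} (hab : a ≤ b) (h : w ≤ a) : clampR a b w = a := by
  rw [clampR, min_eq_left (h.trans hab), max_eq_left h]

theorem clampR_of_ge {a b w : ℝ} (hab : a ≤ b) (h : b ≤ w) : clampR a b w = b := by
  rw [clampR, min_eq_right h, max_eq_right hab]

theorem le_clampR (a b w : ℝ) : a ≤ clampR a b w := le_max_left _ _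

theorem clampR_le {a b : ℝ} (hab : a ≤ b) (w : ℝ) : clampR a b w ≤ b :=
  max_le hab (min_le_right _ _)

theorem clampR_mono (a b : ℝ) : Monotone (clampR a b) := fun _ _ h =>
  max_le_max le_rfl (min_le_min h le_rfl)

theorem clampR_sub_le (a b : ℝ) {x y : ℝ} (h : x ≤ y) : clampR a b y - clampR a b x ≤ y - x := by
  unfold clampR
  rcases max_cases a (min y b) with h1 | h1 <;> rcases max_cases a (min x b) with h2 | h2 <;>
  rcases min_cases y b with h3 | h3 <;> rcases min_cases x b with h4 | h4 <;> linarith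

theorem sub_mul_clampR_sub_nonneg (a b w z : ℝ) : 0 ≤ (w - z) * (clampR a b w - clampR a b z) := by
  rcases le_total w z with h | h
  · exact mul_nonneg_of_nonpos_of_nonpos (by linarith) (by linarith [clampR_mono a b h])
  · exact mul_nonneg (by linarith) (by linarith [clampR_mono a b h])

theorem sub_mul_clampR_sub_le (a b w z : ℝ) :
    (w - z) * (clampR a b w - clampR a b z) ≤ (w - z) ^ 2 := by
  rcases le_total w z with h | h
  · nlinarith [clampR_sub_le a b h]
  · nlinarith [clampR_sub_le a b h]

namespace SteinSandwich

theorem of_abs_sub_le {μ : Measure ℝ} [IsProbabilityMeasure μ] {B M : ℝ}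
    (hB : ∀ᵐ x ∂μ, |x - M| ≤ B) (hM : ∫ x, x ∂μ = M) :
    SteinSandwich (2 * B) M (∫ x, (x - M) ^ 2 ∂μ) μ := by
  have hbdd : ∀ᵐ x ∂μ, |x| ≤ B + |M| := hB.mono fun x hx => by
    have := abs_add_le (x - M) M
    rw [sub_add_cancel] at this
    linarith
  have hint : ∀ {g : ℝ → ℝ}, Continuous g → Integrable g μ := integrable_of_ae_abs_le hbdd
  have hv : 0 ≤ ∫ x, (x - M) ^ 2 ∂μ := integral_nonneg fun _ => sq_nonneg _
  have hcenter : ∀ a b, ∫ w, (w - M) * clampR a b w ∂μ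
      = ∫ w, (w - M) * (clampR a b w - clampR a b M) ∂μ := by
    intro a b
    simp_rw [mul_sub (_ - M)]
    rw [integral_sub (hint (by fun_prop)) (hint (by fun_prop)), integral_mul_const,
      integral_sub (hint (g := fun x => x) continuous_id) (integrable_const _), hM]
    simp
  refine ⟨inferInstance, ⟨_, hbdd⟩, hM, fun a b hab => ?_, fun a b hab => ?_⟩
  · rw [hcenter]
    by_cases hm : M ∈ Icc (a + B) (b - B)
    · calc _ ≤ (∫ x, (x - M) ^ 2 ∂μ) * 1 := by gcongr; exact measureReal_le_one
        _ = _ := by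
          rw [mul_one]
          refine integral_congr_ae (hB.mono fun w hw => ?_)
          obtain ⟨h1, h2⟩ := abs_le.1 hw
          have hw' : w ∈ Icc a b := ⟨by linarith [hm.1], by linarith [hm.2]⟩
          have hM' : M ∈ Icc a b :=
            ⟨by linarith [hm.1, abs_nonneg (w - M)], by linarith [hm.2, abs_nonneg (w - M)]⟩
          simp only [clampR_of_mem hw', clampR_of_mem hM', sq]
    · have h0 : μ.real (Icc (a + 2 * B) (b - 2 * B)) = 0 := by
        rw [measureReal_def, measure_eq_zero_iff_ae_notMem.2, ENNReal.toReal_zero]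
        filter_upwards [hB] with w hw hmem
        obtain ⟨h1, h2⟩ := abs_le.1 hw
        exact hm ⟨by linarith [hmem.1], by linarith [hmem.2]⟩
      rw [h0, mul_zero]
      exact integral_nonneg fun w => sub_mul_clampR_sub_nonneg a b w M
  · rw [hcenter]
    by_cases hm : M ∈ Icc (a - B) (b + B)
    · have h1 : μ.real (Icc (a - 2 * B) (b + 2 * B)) = 1 := by
        rw [measureReal_def, (prob_compl_eq_zero_iff measurableSet_Icc).1, ENNReal.toReal_one]
        rw [measure_eq_zero_iff_ae_notMem]
        filter_upwards [hB] with w hw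
        obtain ⟨h1, h2⟩ := abs_le.1 hw
        exact not_not.2 ⟨by linarith [hm.1], by linarith [hm.2]⟩
      rw [h1, mul_one]
      exact integral_mono (hint (by fun_prop)) (hint (by fun_prop))
        fun w => sub_mul_clampR_sub_le a b w M
    · have h0 : ∫ w, (w - M) * (clampR a b w - clampR a b M) ∂μ = 0 := by
        refine integral_eq_zero_of_ae (hB.mono fun w hw => ?_)
        obtain ⟨h1, h2⟩ := abs_le.1 hw
        have hcases : M ≤ a - B ∨ b + B ≤ M := by
          by_contra! hcon
          exact hm ⟨hcon.1.le, hcon.2.le⟩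
        have hB0 := (abs_nonneg _).trans hw
        rcases hcases with hc | hc
        · simp [clampR_of_le hab (show w ≤ a by linarith),
            clampR_of_le hab (show M ≤ a by linarith)]
        · simp [clampR_of_ge hab (show b ≤ w by linarith),
            clampR_of_ge hab (show b ≤ M by linarith)]
      rw [h0]
      positivity

theorem dirac_zero (D : ℝ) : SteinSandwich D 0 0 (Measure.dirac 0) :=
  ⟨inferInstance, ⟨0, by simp [ae_dirac_eq]⟩, by simp, by simp, by simp⟩

end SteinSandwich

theorem mconvR_eq_conv (μ ν : Measure ℝ) [SFinite ν] : mconvR μ ν = μ.conv ν := by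
  have hmap : Measurable fun x : ℝ => Measure.map (Prod.mk x) ν := Measurable.map_prodMk_left
  have heq : ∀ x : ℝ, ν.map (fun y => x + y)
      = (Measure.map (Prod.mk x) ν).map fun p : ℝ × ℝ => p.1 + p.2 := fun x => by
    rw [Measure.map_map (by fun_prop) (by fun_prop)]
    rfl
  have hmap' : Measurable fun x : ℝ =>
      (Measure.map (Prod.mk x) ν).map fun p : ℝ × ℝ => p.1 + p.2 :=
    (Measure.measurable_map _ (by fun_prop)).comp hmap
  ext S hS
  rw [mconvR, Measure.conv, Measure.map_apply (by fun_prop) hS, Measure.prod,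
    Measure.bind_apply (measurable_add hS) hmap.aemeasurable]
  simp_rw [heq]
  rw [Measure.bind_apply hS hmap'.aemeasurable]
  simp_rw [Measure.map_apply (measurable_add (M := ℝ)) hS]

theorem SteinSandwich.mconvFamR {D : ℝ} : ∀ {s : ℕ} {f : Fin s → Measure ℝ} {M v : Fin s → ℝ},
    (∀ i, SteinSandwich D (M i) (v i) (f i)) →
      SteinSandwich D (∑ i, M i) (∑ i, v i) (mconvFamR f)
  | 0, _, _, _, _ => by simpa [_root_.mconvFamR] using SteinSandwich.dirac_zero D
  | _ + 1, f, M, v, h => by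
    rw [Fin.sum_univ_succ, Fin.sum_univ_succ, _root_.mconvFamR]
    have ih := SteinSandwich.mconvFamR fun i => h i.succ
    have := ih.prob
    rw [mconvR_eq_conv]
    exact (h 0).conv ih

namespace SteinSandwich

variable {D M v σ : ℝ} {μ : Measure ℝ}

theorem integral_sq (h : SteinSandwich D M v μ) (hD : 0 ≤ D) : ∫ w, (w - M) ^ 2 ∂μ = v := by
  have := h.prob
  obtain ⟨b, hb⟩ := h.bdd
  have hb0 : 0 ≤ b := by
    obtain ⟨x, hx⟩ := hb.exists
    exact (abs_nonneg x).trans hx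
  have hone : ∀ c ≥ b, μ.real (Icc (-c) c) = 1 := fun c hc => by
    rw [measureReal_def, (prob_compl_eq_zero_iff measurableSet_Icc).1, ENNReal.toReal_one]
    rw [measure_eq_zero_iff_ae_notMem]
    filter_upwards [hb] with w hw
    exact not_not.2 (abs_le.1 (hw.trans hc))
  have hclamp : ∫ w, (w - M) * clampR (-(b + D)) (b + D) w ∂μ = ∫ w, (w - M) * (w - M + M) ∂μ := by
    refine integral_congr_ae (hb.mono fun w hw => ?_)
    obtain ⟨h1, h2⟩ := abs_le.1 hw
    have hw' : w ∈ Icc (-(b + D)) (b + D) := ⟨by linarith, by linarith⟩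
    simp only [clampR_of_mem hw', sub_add_cancel]
  rw [h.integral_mul_add_const (by fun_prop)] at hclamp
  have hl := h.lower (-(b + D)) (b + D) (by linarith)
  have hu := h.upper (-(b + D)) (b + D) (by linarith)
  rw [show -(b + D) + D = -b by ring, show b + D - D = b by ring, hone b le_rfl] at hl
  rw [show -(b + D) - D = -(b + 2 * D) by ring, show b + D + D = b + 2 * D by ring,
    hone _ (by linarith)] at hu
  simp_rw [sq]
  linarith

theorem integral_abs_le (h : SteinSandwich D M (σ ^ 2) μ) (hD : 0 ≤ D) (hσ : 0 < σ) :
    ∫ w, |w - M| ∂μ ≤ σ := by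
  have := h.prob
  have h1 : ∫ w, |w - M| ∂μ ≤ ∫ w, ((w - M) ^ 2 / (2 * σ) + σ / 2) ∂μ := by
    refine integral_mono (h.integrable (by fun_prop)) (h.integrable (by fun_prop)) fun w => ?_
    simp only
    rw [div_add_div _ _ (by positivity) two_ne_zero, le_div_iff₀ (by positivity)]
    nlinarith [sq_nonneg (|w - M| - σ), sq_abs (w - M)]
  rw [integral_add (h.integrable (by fun_prop)) (integrable_const _), integral_div,
    h.integral_sq hD] at h1
  simp at h1
  refine h1.trans (le_of_eq ?_)
  field_simp
  ring

theorem measureReal_Icc_le (h : SteinSandwich D M (σ ^ 2) μ) (hD : 0 ≤ D) (hσ : 0 < σ) {x y : ℝ}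
    (hxy : x ≤ y) : μ.real (Icc x y) ≤ (y - x + 2 * D) / (2 * σ) := by
  have h1 := h.lower (x - D) (y + D) (by linarith)
  rw [sub_add_cancel, add_sub_cancel_right,
    ← h.integral_mul_add_const (by fun_prop) (-((x + y) / 2))] at h1
  have h2 : ∫ w, (w - M) * (clampR (x - D) (y + D) w + -((x + y) / 2)) ∂μ
      ≤ ∫ w, |w - M| * ((y - x + 2 * D) / 2) ∂μ := by
    refine integral_mono (h.integrable (by fun_prop)) (h.integrable (by fun_prop)) fun w => ?_
    refine (le_abs_self _).trans ?_
    rw [abs_mul]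
    refine mul_le_mul_of_nonneg_left (abs_le.2 ⟨?_, ?_⟩) (abs_nonneg _)
    · linarith [le_clampR (x - D) (y + D) w]
    · linarith [clampR_le (show x - D ≤ y + D by linarith) w]
  rw [integral_mul_const] at h2
  rw [le_div_iff₀ (by positivity)]
  have h3 := mul_le_mul_of_nonneg_right (h.integral_abs_le hD hσ)
    (show 0 ≤ (y - x + 2 * D) / 2 by linarith)
  have h4 : σ * (μ.real (Icc x y) * σ) ≤ σ * ((y - x + 2 * D) / 2) := by nlinarith
  linarith [le_of_mul_le_mul_left h4 hσ]

theorem le_integral_abs (h : SteinSandwich D M (σ ^ 2) μ) (hD : 0 ≤ D) (hσ : 0 < σ)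
    (hDσ : D ≤ σ / 4) : σ / 8 ≤ ∫ w, |w - M| ∂μ := by
  have := h.prob
  have h1 := h.measureReal_Icc_le hD hσ (show M - σ / 2 ≤ M + σ / 2 by linarith)
  have h2 : (M + σ / 2 - (M - σ / 2) + 2 * D) / (2 * σ) ≤ 3 / 4 := by
    rw [div_le_iff₀ (by positivity)]
    linarith
  have hi' : Integrable (fun w => σ / 2 * (Icc (M - σ / 2) (M + σ / 2)).indicator 1 w) μ :=
    ((integrable_const (1 : ℝ)).indicator measurableSet_Icc).const_mul _
  have hi : Integrable (fun w => σ / 2 - σ / 2 * (Icc (M - σ / 2) (M + σ / 2)).indicator 1 w) μ :=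
    (integrable_const _).sub hi'
  have h3 : ∫ w, (σ / 2 - σ / 2 * (Icc (M - σ / 2) (M + σ / 2)).indicator 1 w) ∂μ
      ≤ ∫ w, |w - M| ∂μ := by
    refine integral_mono hi (h.integrable (by fun_prop)) fun w => ?_
    by_cases hw : w ∈ Icc (M - σ / 2) (M + σ / 2)
    · simp [hw]
    · simp only [hw, not_false_eq_true, indicator_of_notMem, mul_zero, sub_zero]
      by_contra! hcon
      obtain ⟨h1, h2⟩ := abs_lt.1 hcon
      exact hw ⟨by linarith, by linarith⟩
  rw [integral_sub (integrable_const _) hi',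
    integral_const_mul, integral_indicator_one measurableSet_Icc] at h3
  simp at h3
  nlinarith

/-- Lower bound for the Stein functional of a short interval to the right of the mean. -/
theorem le_integral_clampR (h : SteinSandwich D M (σ ^ 2) μ) (hD : 0 ≤ D) (hσ : 0 < σ)
    (hDσ : D ≤ σ / 4) {x y : ℝ} (hx : M ≤ x) (hxy : x ≤ y) (hy : y ≤ M + σ / 32) :
    (y - x) * (σ / 32) ≤ ∫ w, (w - M) * clampR x y w ∂μ := by
  have := h.prob
  rw [← h.integral_mul_add_const (by fun_prop) (-x)]
  have h1 : ∫ w, (y - x) * ((|w - M| + (w - M)) / 2 - σ / 32) ∂μ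
      ≤ ∫ w, (w - M) * (clampR x y w + -x) ∂μ := by
    refine integral_mono (h.integrable (by fun_prop)) (h.integrable (by fun_prop)) fun w => ?_
    simp only
    rcases le_total w M with hw | hw
    · rw [clampR_of_le hxy (hw.trans hx), abs_of_nonpos (by linarith)]
      nlinarith
    · rw [abs_of_nonneg (by linarith)]
      rcases le_total y w with hyw | hyw
      · rw [clampR_of_ge hxy hyw]
        nlinarith
      · have : 0 ≤ (w - M) * (clampR x y w + -x) :=
          mul_nonneg (by linarith) (by linarith [le_clampR x y w])
        nlinarith
  rw [integral_const_mul, integral_sub (h.integrable (by fun_prop)) (integrable_const _),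
    integral_div, integral_add (h.integrable (by fun_prop)) (h.integrable (by fun_prop)),
    h.integral_sub_mean] at h1
  simp at h1
  refine le_trans (mul_le_mul_of_nonneg_left ?_ (by linarith)) h1
  linarith [h.le_integral_abs hD hσ hDσ]

theorem integral_clampR_le (h : SteinSandwich D M (σ ^ 2) μ) (hD : 0 ≤ D) (hσ : 0 < σ)
    {t₁ t₂ ℓ m : ℝ} (hℓ : 8 * D ≤ ℓ) (hℓm : ℓ ≤ m) (hm : m ≤ σ / 32)
    (h₁ : M ≤ t₁) (h₁' : t₁ + ℓ ≤ M + m) (h₂ : M ≤ t₂) (h₂' : t₂ + ℓ ≤ M + m) :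
    ∫ w, (w - M) * clampR (t₂ - D) (t₂ + ℓ + D) w ∂μ
      ≤ ∫ w, (w - M) * clampR (t₁ + 2 * D) (t₁ + ℓ - 2 * D) w ∂μ + (6 * D * σ + ℓ * m) := by
  have := h.prob
  set S := Icc (M - D) (M + m + D)
  have hab₁ : t₁ + 2 * D ≤ t₁ + ℓ - 2 * D := by linarith
  have hab₂ : t₂ - D ≤ t₂ + ℓ + D := by linarith
  rw [← h.integral_mul_add_const (by fun_prop) (-(t₂ - D)),
    ← h.integral_mul_add_const (g := clampR (t₁ + 2 * D) (t₁ + ℓ - 2 * D)) (by fun_prop)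
      (-(t₁ + 2 * D))]
  have hS : Integrable (fun w => 4 * m * ℓ * S.indicator 1 w) μ :=
    ((integrable_const (1 : ℝ)).indicator measurableSet_Icc).const_mul _
  have h1 : ∫ w, (w - M) * (clampR (t₂ - D) (t₂ + ℓ + D) w + -(t₂ - D)) ∂μ
      ≤ ∫ w, ((w - M) * (clampR (t₁ + 2 * D) (t₁ + ℓ - 2 * D) w + -(t₁ + 2 * D))
        + 6 * D * |w - M| + 4 * m * ℓ * S.indicator 1 w) ∂μ := by
    refine integral_mono (h.integrable (by fun_prop))
      (Integrable.add (h.integrable (by fun_prop)) hS) fun w => ?_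
    simp only
    by_cases hw : w ∈ S
    · have hc2 : clampR (t₂ - D) (t₂ + ℓ + D) w + -(t₂ - D)
          - (clampR (t₁ + 2 * D) (t₁ + ℓ - 2 * D) w + -(t₁ + 2 * D)) ≤ 2 * ℓ := by
        linarith [clampR_le hab₂ w, le_clampR (t₁ + 2 * D) (t₁ + ℓ - 2 * D) w]
      have hc1 : -(2 * ℓ) ≤ clampR (t₂ - D) (t₂ + ℓ + D) w + -(t₂ - D)
          - (clampR (t₁ + 2 * D) (t₁ + ℓ - 2 * D) w + -(t₁ + 2 * D)) := by
        linarith [clampR_le hab₁ w, le_clampR (t₂ - D) (t₂ + ℓ + D) w]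
      have hw2 : |w - M| ≤ 2 * m := abs_le.2 ⟨by linarith [hw.1], by linarith [hw.2]⟩
      have hmul : (w - M) * (clampR (t₂ - D) (t₂ + ℓ + D) w + -(t₂ - D)
          - (clampR (t₁ + 2 * D) (t₁ + ℓ - 2 * D) w + -(t₁ + 2 * D))) ≤ 2 * m * (2 * ℓ) := by
        refine (le_abs_self _).trans ?_
        rw [abs_mul]
        exact mul_le_mul hw2 (abs_le.2 ⟨hc1, hc2⟩) (abs_nonneg _) (by linarith)
      have h6 : 0 ≤ 6 * D * |w - M| := by positivity
      simp only [hw, indicator_of_mem, Pi.one_apply, mul_one]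
      linarith
    · simp only [hw, not_false_eq_true, indicator_of_notMem, mul_zero, add_zero]
      have hcases : w ≤ M - D ∨ M + m + D ≤ w := by
        by_contra! hcon
        exact hw ⟨hcon.1.le, hcon.2.le⟩
      rcases hcases with hw | hw
      · rw [clampR_of_le hab₁ (by linarith), clampR_of_le hab₂ (by linarith)]
        have h6 : 0 ≤ 6 * D * |w - M| := by positivity
        linarith
      · rw [clampR_of_ge hab₁ (by linarith), clampR_of_ge hab₂ (by linarith),
          abs_of_nonneg (by linarith)]
        linarith
  rw [integral_add (h.integrable (by fun_prop)) hS,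
    integral_add (h.integrable (by fun_prop)) (h.integrable (by fun_prop)), integral_const_mul,
    integral_const_mul, integral_indicator_one measurableSet_Icc] at h1
  have h2 := h.measureReal_Icc_le hD hσ (show M - D ≤ M + m + D by linarith)
  have h3 : (M + m + D - (M - D) + 2 * D) / (2 * σ) ≤ 1 / 4 := by
    rw [div_le_iff₀ (by positivity)]
    linarith
  have h4 := h.integral_abs_le hD hσ
  have h5 := mul_le_mul_of_nonneg_left h4 (show 0 ≤ 6 * D by linarith)
  have h6 := mul_le_mul_of_nonneg_left (h2.trans h3)
    (show 0 ≤ 4 * m * ℓ from mul_nonneg (by linarith) (by linarith))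
  linarith

theorem measureReal_Ioc_le (h : SteinSandwich D M (σ ^ 2) μ) (hD : 0 < D) (hσ : 0 < σ)
    (hDσ : D ≤ σ / 4) {t₁ t₂ ℓ m : ℝ} (hℓ : 8 * D ≤ ℓ) (hℓm : ℓ ≤ m) (hm : m ≤ σ / 32)
    (h₁ : M ≤ t₁) (h₁' : t₁ + ℓ ≤ M + m) (h₂ : M ≤ t₂) (h₂' : t₂ + ℓ ≤ M + m) :
    μ.real (Ioc t₂ (t₂ + ℓ)) ≤ (1 + 64 * (6 * D / ℓ + m / σ)) * μ.real (Ioc t₁ (t₁ + ℓ)) := by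
  have := h.prob
  have hu := h.lower (t₂ - D) (t₂ + ℓ + D) (by linarith)
  rw [sub_add_cancel, add_sub_cancel_right] at hu
  have hl := h.upper (t₁ + 2 * D) (t₁ + ℓ - 2 * D) (by linarith)
  rw [show t₁ + 2 * D - D = t₁ + D by ring,
    show t₁ + ℓ - 2 * D + D = t₁ + ℓ - D by ring] at hl
  have hlow := h.le_integral_clampR hD.le hσ hDσ (show M ≤ t₁ + 2 * D by linarith)
    (show t₁ + 2 * D ≤ t₁ + ℓ - 2 * D by linarith) (by linarith)
  have hcmp := h.integral_clampR_le hD.le hσ hℓ hℓm hm h₁ h₁' h₂ h₂'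
  have hsub₁ : μ.real (Icc (t₁ + D) (t₁ + ℓ - D)) ≤ μ.real (Ioc t₁ (t₁ + ℓ)) :=
    measureReal_mono fun x hx => ⟨by linarith [hx.1], by linarith [hx.2]⟩
  have hsub₂ : μ.real (Ioc t₂ (t₂ + ℓ)) ≤ μ.real (Icc t₂ (t₂ + ℓ)) :=
    measureReal_mono Ioc_subset_Icc_self
  have hℓ0 : 0 < ℓ := by linarith
  set p₁ := μ.real (Ioc t₁ (t₁ + ℓ))
  set p₂ := μ.real (Ioc t₂ (t₂ + ℓ))
  have hσ2 : 0 < σ ^ 2 := by positivity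
  have e₁ := mul_le_mul_of_nonneg_left hsub₁ hσ2.le
  have e₂ := mul_le_mul_of_nonneg_left hsub₂ hσ2.le
  have hp₁ : ℓ * σ / 64 ≤ σ ^ 2 * p₁ := by nlinarith
  have hdiff : σ ^ 2 * p₂ ≤ σ ^ 2 * p₁ + (6 * D * σ + ℓ * m) := by linarith
  have hm0 : 0 ≤ m := by linarith
  have herr : 6 * D * σ + ℓ * m ≤ 64 * (6 * D / ℓ + m / σ) * (σ ^ 2 * p₁) := by
    calc 6 * D * σ + ℓ * m = 64 * (6 * D / ℓ + m / σ) * (ℓ * σ / 64) := by field_simp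
      _ ≤ _ := by gcongr
  refine le_of_mul_le_mul_left ?_ hσ2
  linarith

end SteinSandwich

theorem tilted_conv (μ ν : Measure ℝ) [IsProbabilityMeasure μ] [IsProbabilityMeasure ν] (θ : ℝ) :
    (μ.conv ν).tilted (fun x => θ * x)
      = (μ.tilted fun x => θ * x).conv (ν.tilted fun x => θ * x) := by
  have hZ : ∫ z, Real.exp (θ * z) ∂(μ.conv ν)
      = (∫ x, Real.exp (θ * x) ∂μ) * ∫ y, Real.exp (θ * y) ∂ν := by
    rw [Measure.conv, integral_map (by fun_prop) (Continuous.aestronglyMeasurable (by fun_prop)),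
      ← integral_prod_mul]
    simp_rw [mul_add, Real.exp_add]
  ext S hS
  have hind : Measurable (S.indicator (1 : ℝ → ENNReal)) := measurable_one.indicator hS
  rw [← lintegral_indicator_one hS, ← lintegral_indicator_one hS, lintegral_tilted,
    Measure.lintegral_conv (by fun_prop), Measure.lintegral_conv hind, lintegral_tilted]
  refine lintegral_congr fun x => ?_
  rw [lintegral_tilted, ← lintegral_const_mul _ (by fun_prop)]
  refine lintegral_congr fun y => ?_
  rw [hZ, ← mul_assoc, ← ENNReal.ofReal_mul (by positivity), mul_add, Real.exp_add,
    mul_div_mul_comm]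

theorem tilted_mconvFamR (θ : ℝ) : ∀ {s : ℕ} (f : Fin s → Measure ℝ) {D : ℝ} {M v : Fin s → ℝ},
    (∀ i, SteinSandwich D (M i) (v i) (f i)) →
      (mconvFamR f).tilted (fun x => θ * x) = mconvFamR fun i => (f i).tilted fun x => θ * x
  | 0, f, _, _, _, _ => by
    rw [mconvFamR, mconvFamR, tilted_congr (g := fun _ => θ * 0), tilted_const]
    simp [Filter.EventuallyEq, ae_dirac_eq]
  | _ + 1, f, D, M, v, h => by
    have ih := tilted_mconvFamR θ (fun i => f i.succ) fun i => h i.succ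
    have htail := (SteinSandwich.mconvFamR fun i => h i.succ).prob
    have hhead := (h 0).prob
    rw [mconvFamR, mconvFamR, ← ih, mconvR_eq_conv, mconvR_eq_conv, tilted_conv]

theorem sq_mul_exp_neg_abs_le (u : ℝ) : u ^ 2 * Real.exp (-|u|) ≤ u * (Real.exp u - 1) := by
  rcases le_total 0 u with hu | hu
  · have h1 : Real.exp (-|u|) ≤ 1 := Real.exp_le_one_iff.2 (by simp)
    nlinarith [Real.add_one_le_exp u, sq_nonneg u]
  · rw [abs_of_nonpos hu, neg_neg]
    have h1 := Real.add_one_le_exp (-u)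
    have h2 : Real.exp (-u) * Real.exp u = 1 := by rw [← Real.exp_add]; simp
    have h3 : (-u) * Real.exp u ≤ 1 - Real.exp u := by nlinarith [Real.exp_pos u]
    nlinarith

namespace MemD

variable {c₁ r θ : ℝ} {ν : Measure ℝ}

theorem integrable (h : MemD c₁ r ν) {g : ℝ → ℝ} (hg : Continuous g) : Integrable g ν := by
  have := h.1
  exact integrable_of_ae_abs_le h.2.2.1 hg

theorem le_integral_sq (h : MemD c₁ r ν) (M : ℝ) : c₁ * (r / 2) ^ 2 ≤ ∫ x, (x - M) ^ 2 ∂ν := by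
  have := h.1
  have hv := h.2.2.2
  rw [variance_eq_integral (by fun_prop), h.2.1] at hv
  refine hv.trans ?_
  have : ∫ x, (x - M) ^ 2 ∂ν = ∫ x, ((x - 0) ^ 2 - 2 * M * x + M ^ 2) ∂ν := by
    congr 1; ext x; ring
  rw [this, integral_add (h.integrable (by fun_prop)) (integrable_const _),
    integral_sub (h.integrable (by fun_prop)) (h.integrable (by fun_prop)),
    integral_const_mul, h.2.1]
  simp
  positivity

theorem ae_abs_mul_le (h : MemD c₁ r ν) (hr : 0 < r) (hθ : |θ| ≤ 1 / (8 * r)) :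
    ∀ᵐ x ∂ν, |θ * x| ≤ 1 / 2 := by
  filter_upwards [h.2.2.1] with x hx
  rw [abs_mul]
  calc _ ≤ 1 / (8 * r) * (4 * r) := by gcongr
    _ = 1 / 2 := by field_simp; norm_num

theorem partition_bounds (h : MemD c₁ r ν) (hr : 0 < r) (hθ : |θ| ≤ 1 / (8 * r)) :
    0 < ∫ x, Real.exp (θ * x) ∂ν ∧ ∫ x, Real.exp (θ * x) ∂ν ≤ Real.exp (1 / 2) := by
  have := h.1
  refine ⟨integral_exp_pos (h.integrable (by fun_prop)), ?_⟩
  have : ∫ x, Real.exp (θ * x) ∂ν ≤ ∫ _, Real.exp (1 / 2) ∂ν := by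
    refine integral_mono_ae (h.integrable (by fun_prop)) (integrable_const _) ?_
    filter_upwards [h.ae_abs_mul_le hr hθ] with x hx
    exact Real.exp_le_exp.2 ((le_abs_self _).trans hx)
  simpa using this

/-- A lower bound transfers to the tilted law at the cost of a factor `e⁻¹`. -/
theorem exp_neg_one_mul_le_div (h : MemD c₁ r ν) (hr : 0 < r) (hθ : |θ| ≤ 1 / (8 * r))
    {A I : ℝ} (hA : 0 ≤ A) (hI : Real.exp (-(1 / 2)) * A ≤ I) :
    Real.exp (-1) * A ≤ I / ∫ x, Real.exp (θ * x) ∂ν := by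
  obtain ⟨hZ, hZ'⟩ := h.partition_bounds hr hθ
  rw [le_div_iff₀ hZ]
  calc Real.exp (-1) * A * ∫ x, Real.exp (θ * x) ∂ν
      ≤ Real.exp (-1) * A * Real.exp (1 / 2) := by gcongr
    _ = Real.exp (-(1 / 2)) * A := by
      rw [mul_right_comm, ← Real.exp_add]; norm_num
    _ ≤ I := hI

theorem integral_tilted_eq (g : ℝ → ℝ) :
    ∫ x, g x ∂(ν.tilted fun x => θ * x)
      = (∫ x, Real.exp (θ * x) * g x ∂ν) / ∫ x, Real.exp (θ * x) ∂ν := by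
  rw [integral_tilted, ← integral_div]
  congr 1; ext x
  rw [smul_eq_mul]; ring

theorem le_mul_integral_tilted (h : MemD c₁ r ν) (hr : 0 < r) (hθ : |θ| ≤ 1 / (8 * r)) :
    θ ^ 2 * (Real.exp (-1) * ∫ x, x ^ 2 ∂ν) ≤ θ * ∫ x, x ∂(ν.tilted fun x => θ * x) := by
  have := h.1
  rw [integral_tilted_eq, ← mul_div_assoc, mul_left_comm]
  refine h.exp_neg_one_mul_le_div hr hθ
    (mul_nonneg (sq_nonneg _) (integral_nonneg fun x => sq_nonneg x)) ?_
  have h0 : θ * ∫ x, Real.exp (θ * x) * x ∂ν = ∫ x, (θ * x) * (Real.exp (θ * x) - 1) ∂ν := by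
    have : ∫ x, (θ * x) * (Real.exp (θ * x) - 1) ∂ν
        = ∫ x, (θ * (Real.exp (θ * x) * x) - θ * x) ∂ν := by
      congr 1; ext x; ring
    rw [this, integral_sub (h.integrable (by fun_prop)) (h.integrable (by fun_prop)),
      integral_const_mul, integral_const_mul, h.2.1]
    simp
  rw [h0, ← integral_const_mul, ← integral_const_mul]
  refine integral_mono_ae (h.integrable (by fun_prop)) (h.integrable (by fun_prop)) ?_
  filter_upwards [h.ae_abs_mul_le hr hθ] with x hx
  refine le_trans ?_ (sq_mul_exp_neg_abs_le (θ * x))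
  rw [← mul_pow, mul_comm]
  gcongr

theorem le_integral_sq_tilted (h : MemD c₁ r ν) (hr : 0 < r) (hθ : |θ| ≤ 1 / (8 * r)) (M : ℝ) :
    Real.exp (-1) * ∫ x, (x - M) ^ 2 ∂ν ≤ ∫ x, (x - M) ^ 2 ∂(ν.tilted fun x => θ * x) := by
  have := h.1
  rw [integral_tilted_eq]
  refine h.exp_neg_one_mul_le_div hr hθ (integral_nonneg fun x => sq_nonneg _) ?_
  rw [← integral_const_mul]
  refine integral_mono_ae (h.integrable (by fun_prop)) (h.integrable (by fun_prop)) ?_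
  filter_upwards [h.ae_abs_mul_le hr hθ] with x hx
  have := (abs_le.1 hx).1
  gcongr

theorem continuous_integral_tilted (h : MemD c₁ r ν) :
    Continuous fun θ : ℝ => ∫ x, x ∂(ν.tilted fun x => θ * x) := by
  have huniv : interior (integrableExpSet (fun x : ℝ => x) ν) = Set.univ := by
    rw [show integrableExpSet (fun x : ℝ => x) ν = Set.univ from
      Set.eq_univ_of_forall fun t => h.integrable (by fun_prop), interior_univ]
  rw [continuous_iff_continuousAt]
  intro θ
  have heq : (fun θ : ℝ => ∫ x, x ∂(ν.tilted fun x => θ * x)) = deriv (cgf (fun x : ℝ => x) ν) :=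
    funext fun t => integral_tilted_mul_self (by simp [huniv])
  rw [heq]
  exact (analyticAt_cgf (by simp [huniv])).deriv.continuousAt

theorem steinSandwich_tilted (h : MemD c₁ r ν) (θ : ℝ) :
    SteinSandwich (16 * r) (∫ x, x ∂(ν.tilted fun x => θ * x))
      (∫ x, (x - ∫ x, x ∂(ν.tilted fun x => θ * x)) ^ 2 ∂(ν.tilted fun x => θ * x))
      (ν.tilted fun x => θ * x) := by
  have := h.1
  have := isProbabilityMeasure_tilted (μ := ν) (f := fun x => θ * x) (h.integrable (by fun_prop))
  have hb : ∀ᵐ x ∂(ν.tilted fun x => θ * x), |x| ≤ 4 * r :=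
    (tilted_absolutelyContinuous ν _).ae_le h.2.2.1
  have hM : |∫ x, x ∂(ν.tilted fun x => θ * x)| ≤ 4 * r := by
    simpa using norm_integral_le_of_norm_le_const (f := fun x : ℝ => x) hb
  rw [show 16 * r = 2 * (8 * r) by ring]
  refine SteinSandwich.of_abs_sub_le ?_ rfl
  filter_upwards [hb] with x hx
  rw [abs_le] at *
  constructor <;> linarith

end MemD

theorem tilted_measureReal_bounds {μ : Measure ℝ} [IsProbabilityMeasure μ] {θ : ℝ}
    (hint : Integrable (fun x => Real.exp (θ * x)) μ) {S : Set ℝ} (hS : MeasurableSet S) {a m : ℝ}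
    (hSm : S ⊆ Icc a (a + m)) :
    Real.exp (θ * a - |θ| * m) / (∫ x, Real.exp (θ * x) ∂μ) * μ.real S
        ≤ (μ.tilted fun x => θ * x).real S ∧
      (μ.tilted fun x => θ * x).real S
        ≤ Real.exp (θ * a + |θ| * m) / (∫ x, Real.exp (θ * x) ∂μ) * μ.real S := by
  have hZ := integral_exp_pos hint
  have hdist : ∀ x ∈ S, |θ * x - θ * a| ≤ |θ| * m := fun x hx => by
    obtain ⟨h1, h2⟩ := hSm hx
    rw [← mul_sub, abs_mul, abs_of_nonneg (sub_nonneg.2 h1)]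
    gcongr
    linarith
  have hi : IntegrableOn (fun x => Real.exp (θ * x) / ∫ x, Real.exp (θ * x) ∂μ) S μ :=
    (hint.div_const _).integrableOn
  have hc : ∀ c : ℝ, IntegrableOn (fun _ => c) S μ := fun c => (integrable_const c).integrableOn
  have hconst : ∀ c : ℝ, c * μ.real S = ∫ _ in S, c ∂μ := fun c => by
    rw [setIntegral_const, smul_eq_mul, mul_comm]
  rw [measureReal_def (μ.tilted _), tilted_apply_eq_ofReal_integral' _ hS,
    ENNReal.toReal_ofReal (setIntegral_nonneg hS fun _ _ => by positivity), hconst, hconst]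
  constructor
  · refine setIntegral_mono_on (hc _) hi hS fun x hx => ?_
    have := (abs_le.1 (hdist x hx)).1
    gcongr
    linarith
  · refine setIntegral_mono_on hi (hc _) hS fun x hx => ?_
    have := (abs_le.1 (hdist x hx)).2
    gcongr
    linarith

theorem exists_tilt {c₁ r : ℝ} (hr : 0 < r) {s : ℕ} {f : Fin s → Measure ℝ}
    (hf : ∀ i, MemD c₁ r (f i)) {T a : ℝ} (hT : 0 < T) (hTr : T ≤ 1 / (8 * r))
    (ha : |a| ≤ s * (T * (Real.exp (-1) * (c₁ * (r / 2) ^ 2)))) :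
    ∃ θ, |θ| ≤ T ∧ ∑ i, ∫ x, x ∂((f i).tilted fun x => θ * x) = a := by
  set φ : ℝ → ℝ := fun θ => ∑ i, ∫ x, x ∂((f i).tilted fun x => θ * x) with hφ
  have hcont : Continuous φ := continuous_finsetSum _ fun i _ => (hf i).continuous_integral_tilted
  have hmul : ∀ θ, |θ| ≤ 1 / (8 * r) →
      θ ^ 2 * (s * (Real.exp (-1) * (c₁ * (r / 2) ^ 2))) ≤ θ * φ θ := by
    intro θ hθ
    have : ∑ _i : Fin s, θ ^ 2 * (Real.exp (-1) * (c₁ * (r / 2) ^ 2)) ≤ θ * φ θ := by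
      rw [hφ, Finset.mul_sum]
      refine Finset.sum_le_sum fun i _ => le_trans ?_ ((hf i).le_mul_integral_tilted hr hθ)
      have := (hf i).le_integral_sq 0
      simp only [sub_zero] at this
      gcongr
    simp only [Finset.sum_const, Finset.card_univ, Fintype.card_fin, nsmul_eq_mul] at this
    linarith
  obtain ⟨ha1, ha2⟩ := abs_le.1 ha
  have hpos := hmul T (by rwa [abs_of_pos hT])
  have hneg := hmul (-T) (by rwa [abs_neg, abs_of_pos hT])
  have h1 : φ (-T) ≤ a := by nlinarith
  have h2 : a ≤ φ T := by nlinarith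
  obtain ⟨θ, hθ, rfl⟩ := intermediate_value_Icc (show -T ≤ T by linarith) hcont.continuousOn ⟨h1, h2⟩
  exact ⟨θ, abs_le.2 hθ, rfl⟩

theorem MemD.steinSandwich {c₁ r : ℝ} {ν : Measure ℝ} (h : MemD c₁ r ν) :
    ∃ M v, SteinSandwich (16 * r) M v ν := by
  have := h.1
  have h0 := h.steinSandwich_tilted 0
  simp only [zero_mul, tilted_const] at h0
  exact ⟨_, _, h0⟩

theorem exp_mul_le_one_add {b u : ℝ} (hu : 0 ≤ u) (hu' : u ≤ 1) :
    Real.exp (b * u) ≤ 1 + Real.exp b * u := by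
  have := convexOn_exp.2 (mem_univ 0) (mem_univ b) (sub_nonneg.2 hu') hu (by ring)
  simp only [smul_eq_mul, mul_zero, zero_add, Real.exp_zero, mul_one] at this
  rw [mul_comm b]
  linarith

/-- One-sided comparison after tilting the mean to the left end `a` of the ambient interval. -/
theorem measureReal_Ioc_le_of_tilt {c₁ r : ℝ} (hr : 0 < r) {s : ℕ}
    {f : Fin s → Measure ℝ} (hf : ∀ i, MemD c₁ r (f i)) {T σ a m ℓ t₁ t₂ : ℝ} (hT : 0 < T)
    (hTr : T ≤ 1 / (8 * r)) (ha : |a| ≤ s * (T * (Real.exp (-1) * (c₁ * (r / 2) ^ 2))))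
    (hσ : 0 < σ) (hσs : σ ^ 2 ≤ s * (Real.exp (-1) * (c₁ * (r / 2) ^ 2)))
    (hℓ : 128 * r ≤ ℓ) (hℓm : ℓ ≤ m) (hm : m ≤ σ / 32)
    (h₁ : a ≤ t₁) (h₁' : t₁ + ℓ ≤ a + m) (h₂ : a ≤ t₂) (h₂' : t₂ + ℓ ≤ a + m) :
    (mconvFamR f).real (Ioc t₂ (t₂ + ℓ))
      ≤ Real.exp (2 * T * m) * (1 + 64 * (96 * r / ℓ + m / σ))
        * (mconvFamR f).real (Ioc t₁ (t₁ + ℓ)) := by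
  obtain ⟨θ, hθ, hmean⟩ := exists_tilt hr hf hT hTr ha
  choose M v hMv using fun i => (hf i).steinSandwich
  have hμ := SteinSandwich.mconvFamR hMv
  have hprob := hμ.prob
  have hρ := SteinSandwich.mconvFamR fun i => (hf i).steinSandwich_tilted θ
  rw [hmean, ← tilted_mconvFamR θ f hMv] at hρ
  set V := ∑ i, ∫ x, (x - ∫ x, x ∂((f i).tilted fun x => θ * x)) ^ 2
    ∂((f i).tilted fun x => θ * x) with hV
  have hσV : σ ^ 2 ≤ V := by
    have : ∑ _i : Fin s, Real.exp (-1) * (c₁ * (r / 2) ^ 2) ≤ V := by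
      refine Finset.sum_le_sum fun i _ =>
        le_trans ?_ ((hf i).le_integral_sq_tilted hr (hθ.trans hTr) _)
      gcongr
      exact (hf i).le_integral_sq _
    simp only [Finset.sum_const, Finset.card_univ, Fintype.card_fin, nsmul_eq_mul] at this
    linarith
  have hsqrt : σ ≤ √V := Real.le_sqrt_of_sq_le hσV
  rw [← Real.sq_sqrt (show 0 ≤ V by nlinarith)] at hρ
  have hcmp := hρ.measureReal_Ioc_le (by positivity) (by linarith) (by linarith)
    (show 8 * (16 * r) ≤ ℓ by linarith) hℓm (by linarith) h₁ h₁' h₂ h₂'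
  have hint : Integrable (fun x => Real.exp (θ * x)) (mconvFamR f) := hμ.integrable (by fun_prop)
  have hsub : ∀ {t}, a ≤ t → t + ℓ ≤ a + m → Ioc t (t + ℓ) ⊆ Icc a (a + m) :=
    fun h h' x hx => ⟨by linarith [hx.1], by linarith [hx.2]⟩
  have hlow := (tilted_measureReal_bounds hint measurableSet_Ioc (hsub h₂ h₂')).1
  have hupp := (tilted_measureReal_bounds hint measurableSet_Ioc (hsub h₁ h₁')).2
  have hZ := integral_exp_pos hint
  set Z := ∫ x, Real.exp (θ * x) ∂(mconvFamR f)
  set ρ := (mconvFamR f).tilted fun x => θ * x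
  set q₁ := (mconvFamR f).real (Ioc t₁ (t₁ + ℓ))
  set q₂ := (mconvFamR f).real (Ioc t₂ (t₂ + ℓ))
  have hm0 : 0 ≤ m := by linarith
  have hℓ0 : 0 < ℓ := by linarith
  have hfac : 1 + 64 * (6 * (16 * r) / ℓ + m / √V) ≤ 1 + 64 * (96 * r / ℓ + m / σ) := by
    rw [show 6 * (16 * r) = 96 * r by ring]
    gcongr
  set F := 1 + 64 * (96 * r / ℓ + m / σ)
  have hF : 0 ≤ F := by positivity
  have hall : Real.exp (θ * a - |θ| * m) / Z * q₂
      ≤ F * (Real.exp (θ * a + |θ| * m) / Z * q₁) :=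
    hlow.trans (hcmp.trans (mul_le_mul hfac hupp measureReal_nonneg hF))
  have hsplit : Real.exp (θ * a + |θ| * m)
      = Real.exp (θ * a - |θ| * m) * Real.exp (2 * |θ| * m) := by
    rw [← Real.exp_add]; congr 1; ring
  have hpos : 0 < Real.exp (θ * a - |θ| * m) / Z := by positivity
  have hq : q₂ ≤ Real.exp (2 * |θ| * m) * F * q₁ := by
    refine le_of_mul_le_mul_left (hall.trans (le_of_eq ?_)) hpos
    rw [hsplit]; ring
  refine hq.trans ?_
  have : 0 ≤ q₁ := measureReal_nonneg
  gcongr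

theorem exists_local_comparison {c₁ K : ℝ} (hc₁ : 0 < c₁) (hK : 0 < K) :
    ∃ C₀ η C : ℝ, 0 < C₀ ∧ 0 < η ∧ η ≤ 1 ∧ 0 < C ∧ ∀ {r : ℝ}, 0 < r → ∀ {s : ℕ}, 0 < s →
      ∀ {lam m ℓ : ℝ}, 1 ≤ lam → C₀ * r ≤ ℓ → ℓ ≤ m → lam * m / (r * √s) ≤ η →
      ∀ {μ : Measure ℝ}, MemB c₁ r s μ → ∀ {a t₁ t₂ : ℝ}, |a| ≤ K * lam * r * √s →
        a ≤ t₁ → t₁ + ℓ ≤ a + m → a ≤ t₂ → t₂ + ℓ ≤ a + m →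
        μ.real (Ioc t₂ (t₂ + ℓ))
          ≤ (1 + C * (r / ℓ + lam * m / (r * √s))) * μ.real (Ioc t₁ (t₁ + ℓ)) := by
  set κ := Real.exp (-1) * c₁ / 4 with hκ
  have hκ0 : 0 < κ := by positivity
  set q := √κ with hq
  have hq0 : 0 < q := Real.sqrt_pos.2 hκ0
  have hqq : q ^ 2 = κ := Real.sq_sqrt hκ0.le
  set E := Real.exp (2 * K / κ)
  have hE : 0 < E := Real.exp_pos _
  refine ⟨128 + 8 * K / κ, min 1 (q / 32), E + (6144 + 64 / q) + E * (6144 + 64 / q),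
    by positivity, by positivity, min_le_left _ _, by positivity, ?_⟩
  intro r hr s hs lam m ℓ hlam hℓ hℓm hη μ ⟨f, hf, hμ⟩ a t₁ t₂ ha h₁ h₁' h₂ h₂'
  subst hμ
  have hS : 0 < √(s : ℝ) := Real.sqrt_pos.2 (by exact_mod_cast hs)
  have hSS : √(s : ℝ) ^ 2 = s := Real.sq_sqrt (by positivity)
  set S := √(s : ℝ)
  have hvar : Real.exp (-1) * (c₁ * (r / 2) ^ 2) = κ * r ^ 2 := by rw [hκ]; ring
  set C₀ := 128 + 8 * K / κ with hC₀
  have hC₀0 : 0 < C₀ := by positivity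
  have hℓ0 : 0 < ℓ := lt_of_lt_of_le (by positivity) hℓ
  have hm0 : 0 < m := hℓ0.trans_le hℓm
  set u := lam * m / (r * S) with hu
  have hu0 : 0 ≤ u := by positivity
  have hu1 : u ≤ 1 := hη.trans (min_le_left _ _)
  have hm1 : lam * m ≤ r * S := by
    rwa [hu, div_le_one (by positivity)] at hu1
  have hlamS : lam * C₀ ≤ S := by
    have : lam * (C₀ * r) ≤ lam * m := by gcongr; linarith
    exact le_of_mul_le_mul_left (by linarith) hr
  have hKq : 0 < 8 * K / κ := by positivity
  have h128 : 128 * r ≤ ℓ := (by gcongr; linarith : 128 * r ≤ C₀ * r).trans hℓ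
  have hmlam : m ≤ lam * m := le_mul_of_one_le_left hm0.le hlam
  have hmq : m / (q * r * S) ≤ u / q := by
    rw [hu, div_div, show r * S * q = q * r * S by ring]
    gcongr
  have hmain := measureReal_Ioc_le_of_tilt (T := K * lam / (κ * r * S)) (σ := q * r * S)
    (a := a) (m := m) (ℓ := ℓ) (t₁ := t₁) (t₂ := t₂) hr hf (by positivity) ?_ ?_ (by positivity)
    ?_ h128 hℓm ?_ h₁ h₁' h₂ h₂'
  · refine hmain.trans (mul_le_mul_of_nonneg_right ?_ measureReal_nonneg)
    have hexp : Real.exp (2 * (K * lam / (κ * r * S)) * m) ≤ 1 + E * u := by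
      rw [show 2 * (K * lam / (κ * r * S)) * m = 2 * K / κ * u by rw [hu]; field_simp]
      exact exp_mul_le_one_add hu0 hu1
    have hw0 : 0 ≤ r / ℓ := by positivity
    have hw1 : r / ℓ ≤ 1 := by
      rw [div_le_one hℓ0]
      linarith
    set w := r / ℓ
    have hfac : 1 + 64 * (96 * r / ℓ + m / (q * r * S)) ≤ 1 + (6144 * w + 64 / q * u) := by
      rw [mul_div_assoc, show (64 : ℝ) / q * u = 64 * (u / q) by ring]
      linarith
    calc _ ≤ (1 + E * u) * (1 + (6144 * w + 64 / q * u)) := by gcongr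
      _ ≤ _ := by
        have e1 : E * u * (6144 * w + 64 / q * u) ≤ E * u * (6144 * 1 + 64 / q * 1) := by gcongr
        have e2 : 0 ≤ E * w := by positivity
        have e3 : 0 ≤ E * (6144 + 64 / q) * w := by positivity
        have e4 : 0 ≤ 64 / q * w := by positivity
        linarith
  · rw [div_le_div_iff₀ (by positivity) (by positivity)]
    have : lam * (8 * K / κ) ≤ S := le_trans (by gcongr; linarith) hlamS
    rw [mul_div_assoc', div_le_iff₀ hκ0] at this
    have := mul_le_mul_of_nonneg_right this hr.le
    linarith
  · rw [hvar]
    refine ha.trans (le_of_eq ?_)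
    rw [← hSS]
    field_simp
  · rw [hvar, mul_pow, mul_pow, hqq, hSS]
    linarith
  · have := hη.trans (min_le_right _ _)
    rw [hu, div_le_iff₀ (by positivity)] at this
    linarith

/-- Iterating a bounded-ratio estimate for steps of length at most `d`. -/
theorem le_pow_mul_of_forall_abs_sub_le {g : ℝ → ℝ} {A lo hi d : ℝ} (hA : 0 ≤ A)
    (h : ∀ x y, x ∈ Icc lo hi → y ∈ Icc lo hi → |x - y| ≤ d → g y ≤ A * g x) (n : ℕ) :
    ∀ x y, x ∈ Icc lo hi → y ∈ Icc lo hi → |x - y| ≤ (n + 1) * d → g y ≤ A ^ (n + 1) * g x := by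
  induction n with
  | zero => simpa using h
  | succ n ih =>
    intro x y hx hy hxy
    push_cast at hxy
    have hn : (0 : ℝ) < n + 2 := by positivity
    set z := y + (x - y) / (n + 2) with hz
    have hzmem : z ∈ Icc lo hi := by
      have : z = ((1 : ℝ) / (n + 2)) • x + (((n : ℝ) + 1) / (n + 2)) • y := by
        simp only [hz, smul_eq_mul]; field_simp; ring
      rw [this]
      exact convex_Icc lo hi hx hy (by positivity) (by positivity) (by field_simp; ring)
    have hzy : |z - y| ≤ d := by
      rw [hz, add_sub_cancel_left, abs_div, abs_of_pos hn, div_le_iff₀ hn]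
      linarith
    have hxz : |x - z| ≤ (n + 1) * d := by
      have : x - z = (n + 1) / (n + 2) * (x - y) := by rw [hz]; field_simp; ring
      rw [this, abs_mul, abs_of_nonneg (by positivity), div_mul_eq_mul_div, div_le_iff₀ hn]
      have h1 : (0 : ℝ) < n + 1 := by positivity
      nlinarith
    calc g y ≤ A * g z := h z y hzmem hy hzy
      _ ≤ A * (A ^ (n + 1) * g x) := by gcongr; exact ih x z hx hzmem hxz
      _ = A ^ (n + 1 + 1) * g x := by ring

theorem measureReal_Ioc_eq_sum (μ : Measure ℝ) [IsFiniteMeasure μ] (t : ℝ) {L : ℝ} (hL : 0 ≤ L)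
    (n : ℕ) : μ.real (Ioc t (t + n * L))
      = ∑ j ∈ Finset.range n, μ.real (Ioc (t + j * L) (t + j * L + L)) := by
  induction n with
  | zero => simp
  | succ n ih =>
    have hn : 0 ≤ n * L := by positivity
    rw [Finset.sum_range_succ, ← ih, ← measureReal_union (Ioc_disjoint_Ioc_of_le le_rfl)
      measurableSet_Ioc, Ioc_union_Ioc_eq_Ioc (by linarith) (by linarith)]
    push_cast
    ring_nf

theorem exists_one_sided_comparison {c₁ K : ℝ} (hc₁ : 0 < c₁) (hK : 0 < K) :
    ∃ C' C : ℝ, 0 < C' ∧ 0 < C ∧ ∀ {r : ℝ}, 0 < r → ∀ {s : ℕ}, 0 < s →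
      ∀ {lam m ℓ : ℝ}, 1 ≤ lam → C' * r ≤ ℓ → ℓ ≤ m → lam * m / (r * √s) ≤ K →
      ∀ {μ : Measure ℝ} [IsProbabilityMeasure μ], MemB c₁ r s μ → ∀ {a t₁ t₂ : ℝ},
        Icc a (a + m) ⊆ Icc (-(K * lam * r * √s)) (K * lam * r * √s) →
        a ≤ t₁ → t₁ + ℓ ≤ a + m → a ≤ t₂ → t₂ + ℓ ≤ a + m →
        μ.real (Ioc t₂ (t₂ + ℓ))
          ≤ (1 + C * (r / ℓ + lam * m / (r * √s))) * μ.real (Ioc t₁ (t₁ + ℓ)) := by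
  obtain ⟨C₀, η, C, hC₀, hη, hη1, hC, hloc⟩ := exists_local_comparison hc₁ hK
  obtain ⟨n, hn⟩ := exists_nat_ge (2 * K / η)
  set A := 1 + C * (1 / C₀ + η) with hA
  have hA0 : 1 ≤ A := by
    have : 0 < C * (1 / C₀ + η) := by positivity
    linarith
  have hn1 : (0 : ℝ) < n + 1 := by positivity
  refine ⟨(n + 1) * C₀, C + A ^ (n + 1) / η, by positivity, by positivity, ?_⟩
  intro r hr s hs lam m ℓ hlam hℓ hℓm hlamK μ _ hμ a t₁ t₂ hJ h₁ h₁' h₂ h₂'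
  have hS : 0 < √(s : ℝ) := Real.sqrt_pos.2 (by exact_mod_cast hs)
  have hℓ0 : 0 < ℓ := lt_of_lt_of_le (by positivity) hℓ
  have hm0 : 0 < m := hℓ0.trans_le hℓm
  set p₁ := μ.real (Ioc t₁ (t₁ + ℓ)) with hp₁
  have hp₁0 : 0 ≤ p₁ := measureReal_nonneg
  set u := lam * m / (r * √s) with hu
  have hu0 : 0 < u := by positivity
  have hw0 : 0 < r / ℓ := by positivity
  have habs : ∀ x ∈ Icc a (a + m), |x| ≤ K * lam * r * √s := fun x hx => abs_le.2 (hJ hx)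
  rcases le_total u η with hsmall | hlarge
  · have hC₀r : C₀ * r ≤ (n + 1) * C₀ * r := by
      have : (0 : ℝ) ≤ n * (C₀ * r) := by positivity
      linarith
    refine (hloc hr hs hlam (hC₀r.trans hℓ) hℓm hsmall hμ
      (habs a ⟨le_rfl, by linarith⟩) h₁ h₁' h₂ h₂').trans ?_
    gcongr
    have : 0 ≤ A ^ (n + 1) / η := by positivity
    linarith
  · set L := ℓ / (n + 1) with hL
    set d := m / (n + 1) with hd
    have hd0 : 0 < d := by positivity
    have hL0 : 0 < L := by positivity
    have hLd : L ≤ d := by rw [hL, hd]; gcongr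
    have hℓL : ℓ = ((n + 1 : ℕ) : ℝ) * L := by rw [hL]; push_cast; field_simp
    have hC₀L : C₀ * r ≤ L := by
      rw [hL, le_div_iff₀ hn1]
      linarith
    have hdη : lam * (2 * d) / (r * √s) ≤ η := by
      have h1 : lam * (2 * d) / (r * √s) = 2 * u / (n + 1) := by rw [hd, hu]; ring
      rw [h1, div_le_iff₀ hn1]
      rw [div_le_iff₀ hη] at hn
      nlinarith
    have hstep : ∀ x y, x ∈ Icc a (a + m - L) → y ∈ Icc a (a + m - L) → |x - y| ≤ d →
        μ.real (Ioc y (y + L)) ≤ A * μ.real (Ioc x (x + L)) := by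
      intro x y hx hy hxy
      obtain ⟨hxy1, hxy2⟩ := abs_le.1 hxy
      have hmin : min x y ∈ Icc a (a + m) :=
        ⟨le_min hx.1 hy.1, (min_le_left _ _).trans (by linarith [hx.2])⟩
      have hxm : x ≤ min x y + d := by rcases min_cases x y with h | h <;> linarith
      have hym : y ≤ min x y + d := by rcases min_cases x y with h | h <;> linarith
      refine (hloc hr hs hlam hC₀L (show L ≤ 2 * d by linarith) hdη hμ (habs _ hmin)
        (min_le_left _ _) (by linarith) (min_le_right _ _) (by linarith)).trans ?_
      have hrL : r / L ≤ 1 / C₀ := by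
        rw [div_le_div_iff₀ hL0 hC₀]
        linarith
      rw [hA]
      gcongr
    have hchain := le_pow_mul_of_forall_abs_sub_le (g := fun x => μ.real (Ioc x (x + L)))
      (by linarith) hstep n
    have hpow : μ.real (Ioc t₂ (t₂ + ℓ)) ≤ A ^ (n + 1) * p₁ := by
      rw [hp₁, hℓL, measureReal_Ioc_eq_sum μ t₂ hL0.le, measureReal_Ioc_eq_sum μ t₁ hL0.le,
        Finset.mul_sum]
      refine Finset.sum_le_sum fun j hj => ?_
      have hj0 : 0 ≤ j * L := by positivity
      have hj1 : j * L + L ≤ ℓ := by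
        have : ((j + 1 : ℕ) : ℝ) ≤ ((n + 1 : ℕ) : ℝ) := by
          exact_mod_cast Finset.mem_range.1 hj
        rw [hℓL, ← add_one_mul]
        push_cast at this ⊢
        gcongr
      refine hchain _ _ ⟨by linarith, by linarith⟩ ⟨by linarith, by linarith⟩ ?_
      have hmd : ((n : ℝ) + 1) * d = m := by rw [hd]; field_simp
      rw [hmd, abs_le]
      constructor <;> linarith
    refine hpow.trans (mul_le_mul_of_nonneg_right ?_ hp₁0)
    have h1 : A ^ (n + 1) ≤ A ^ (n + 1) / η * u := by
      rw [div_mul_eq_mul_div, le_div_iff₀ hη]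
      gcongr
    have h2 : 0 ≤ C * (r / ℓ + u) := by positivity
    have h3 : 0 ≤ A ^ (n + 1) / η * (r / ℓ) := by positivity
    linarith

theorem bounds_of_Ioc_subset_Icc {t ℓ a b : ℝ} (hℓ : 0 < ℓ) (h : Ioc t (t + ℓ) ⊆ Icc a b) :
    a ≤ t ∧ t + ℓ ≤ b := by
  have hcl := closure_minimal h isClosed_Icc
  rw [closure_Ioc (by linarith)] at hcl
  exact ⟨(hcl (left_mem_Icc.2 (by linarith))).1, (hcl (right_mem_Icc.2 (by linarith))).2⟩

/-- **Tilting lemma.**  For `X` with law in `ℬ_{r,s}` and half-open intervals `I₁, I₂` of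
length `ℓ` inside an interval `J` of length `m` with `J ⊆ [−Kλr√s, Kλr√s]`, under
`λ ≥ 1`, `m ≥ ℓ ≥ C' r` and `λm/(r√s) ≤ K`, the probabilities of `I₁` and `I₂` agree up to
a relative error `C''(r/ℓ + λm/(r√s))`. -/
theorem tilting_lemma (c₁ : ℝ) (hc₁ : 0 < c₁) (K : ℝ) (hK : 0 < K) :
    ∃ C' C'' : ℝ,
      ∀ (r : ℝ), 0 < r → ∀ (s : ℕ), 0 < s → ∀ lam m ℓ : ℝ,
        1 ≤ lam → C' * r ≤ ℓ → ℓ ≤ m → lam * m / (r * Real.sqrt s) ≤ K →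
        ∀ {Ω : Type} [MeasurableSpace Ω] (P : Measure Ω) [IsProbabilityMeasure P]
          (X : Ω → ℝ), Measurable X → MemB c₁ r s (P.map X) →
        ∀ a t₁ t₂ : ℝ,
          Set.Ioc t₁ (t₁ + ℓ) ⊆ Set.Icc a (a + m) →
          Set.Ioc t₂ (t₂ + ℓ) ⊆ Set.Icc a (a + m) →
          Set.Icc a (a + m) ⊆
            Set.Icc (-(K * lam * r * Real.sqrt s)) (K * lam * r * Real.sqrt s) →
          |(P {ω | X ω ∈ Set.Ioc t₂ (t₂ + ℓ)}).toReal
              - (P {ω | X ω ∈ Set.Ioc t₁ (t₁ + ℓ)}).toReal|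
            ≤ C'' * (P {ω | X ω ∈ Set.Ioc t₁ (t₁ + ℓ)}).toReal
                * (r / ℓ + lam * m / (r * Real.sqrt s)) := by
  obtain ⟨C', C, hC', hC, hcmp⟩ := exists_one_sided_comparison hc₁ hK
  refine ⟨C', 2 * C + C * C * (1 / C' + K), ?_⟩
  intro r hr s hs lam m ℓ hlam hℓ hℓm hlamK Ω _ P _ X hX hB a t₁ t₂ h₁ h₂ hJ
  have hS : 0 < √(s : ℝ) := Real.sqrt_pos.2 (by exact_mod_cast hs)
  have hℓ0 : 0 < ℓ := lt_of_lt_of_le (by positivity) hℓ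
  have hm0 : 0 < m := hℓ0.trans_le hℓm
  have hprob : IsProbabilityMeasure (P.map X) := Measure.isProbabilityMeasure_map hX.aemeasurable
  have hlaw : ∀ t, (P {ω | X ω ∈ Set.Ioc t (t + ℓ)}).toReal
      = (P.map X).real (Set.Ioc t (t + ℓ)) := fun t => by
    rw [map_measureReal_apply hX measurableSet_Ioc]
    rfl
  obtain ⟨h₁a, h₁b⟩ := bounds_of_Ioc_subset_Icc hℓ0 h₁
  obtain ⟨h₂a, h₂b⟩ := bounds_of_Ioc_subset_Icc hℓ0 h₂
  have h21 := hcmp hr hs hlam hℓ hℓm hlamK hB hJ h₁a h₁b h₂a h₂b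
  have h12 := hcmp hr hs hlam hℓ hℓm hlamK hB hJ h₂a h₂b h₁a h₁b
  rw [hlaw, hlaw]
  have hrℓ : r / ℓ ≤ 1 / C' := by
    rw [div_le_div_iff₀ hℓ0 hC']
    linarith
  have hp₁ : 0 ≤ (P.map X).real (Set.Ioc t₁ (t₁ + ℓ)) := measureReal_nonneg
  set p₁ := (P.map X).real (Set.Ioc t₁ (t₁ + ℓ))
  set p₂ := (P.map X).real (Set.Ioc t₂ (t₂ + ℓ))
  have hε : 0 ≤ r / ℓ + lam * m / (r * √s) := by positivity
  have hε' : r / ℓ + lam * m / (r * √s) ≤ 1 / C' + K := add_le_add hrℓ hlamK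
  set ε := r / ℓ + lam * m / (r * √s)
  have hC1 : C * ε * p₁ ≤ (2 * C + C * C * (1 / C' + K)) * p₁ * ε := by
    have : 0 ≤ (C + C * C * (1 / C' + K)) * p₁ * ε := by positivity
    linarith
  have hC2 : C * ε * p₂ ≤ C * ε * p₁ + C * C * (1 / C' + K) * p₁ * ε := by
    calc C * ε * p₂ ≤ C * ε * ((1 + C * ε) * p₁) := by gcongr
      _ = C * ε * p₁ + C * C * ε * p₁ * ε := by ring
      _ ≤ _ := by gcongr
  have hC3 : 0 ≤ C * ε * p₁ := by positivity
  rw [abs_le]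
  constructor <;> linarith
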